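/- In a minimal counterexample, every vertex of degree d with d ≥ 8 has at most d − 4 neighbors of degree 5. -/

import Mathlib

open SimpleGraph

variable {V : Type}

/-- The involution of the darts of a graph reversing each dart. -/
def dartRev (G : SimpleGraph V) : Equiv.Perm G.Dart :=
  Function.Involutive.toPerm SimpleGraph.Dart.symm SimpleGraph.Dart.symm_involutive

/-- The face permutation of a rotation system `σ`: it sends a dart `(u,v)` to `σ (v,u)`. -/
def facePerm {G : SimpleGraph V} (σ : Equiv.Perm G.Dart) : Equiv.Perm G.Dart :=
  (dartRev G).trans σ

/-- The setoid on `α` whose classes are the orbits (cycles) of a permutation of `α`. -/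
def orbitSetoid {α : Type*} (f : Equiv.Perm α) : Setoid α :=
  ⟨f.SameCycle, ⟨fun x => Equiv.Perm.SameCycle.refl f x, fun h => h.symm, fun h h' => h.trans h'⟩⟩

/-- The number of faces of a rotation system: the number of orbits of the face permutation. -/
noncomputable def numFaces {G : SimpleGraph V} (σ : Equiv.Perm G.Dart) : ℕ :=
  Nat.card (Quotient (orbitSetoid (facePerm σ)))

/-- The number of darts in the face (orbit of the face permutation) containing the dart `d`. -/
noncomputable def faceSize {G : SimpleGraph V} (σ : Equiv.Perm G.Dart) (d : G.Dart) : ℕ :=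
  Nat.card {e : G.Dart // (facePerm σ).SameCycle d e}

/-- `σ` is a rotation system on `G`: every dart and its image share their first vertex, and
the `σ`-orbit of every dart consists of all darts sharing its first vertex. -/
structure IsRotationSystem (G : SimpleGraph V) (σ : Equiv.Perm G.Dart) : Prop where
  fst_eq : ∀ d : G.Dart, (σ d).toProd.1 = d.toProd.1
  orbit_eq : ∀ d e : G.Dart, d.toProd.1 = e.toProd.1 → σ.SameCycle d e

/-- The degree of a vertex. -/
noncomputable def deg (G : SimpleGraph V) (v : V) : ℕ := Nat.card (G.neighborSet v)

/-- A plane triangulation: a finite connected simple graph on at least 4 vertices equipped with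
a rotation system satisfying Euler's formula `|V| - |E| + F = 2` in which every face consists of
exactly 3 darts. -/
structure IsPlaneTriangulation [Fintype V] (G : SimpleGraph V) (σ : Equiv.Perm G.Dart) :
    Prop where
  connected : G.Connected
  four_le_card : 4 ≤ Fintype.card V
  rot : IsRotationSystem G σ
  euler : Fintype.card V + numFaces σ = Nat.card G.edgeSet + 2
  face_size_eq : ∀ d : G.Dart, faceSize σ d = 3

/-- A proper 5-coloring (colors `0,...,4` standing for `1,...,5`). -/
def Proper5 (G : SimpleGraph V) (c : V → Fin 5) : Prop :=
  ∀ ⦃u w : V⦄, G.Adj u w → c u ≠ c w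

/-- A finite simple graph is planar if it is isomorphic to a subgraph of a plane triangulation. -/
def IsPlanar [Fintype V] (G : SimpleGraph V) : Prop :=
  ∃ (W : Type) (iW : Fintype W) (T : SimpleGraph W) (σ : Equiv.Perm T.Dart),
    @IsPlaneTriangulation W iW T σ ∧ ∃ f : G →g T, Function.Injective f

/-- `w` is the neighbor of `v` following `u` in the cyclic (counterclockwise) order
around `v` given by the rotation system `σ`. -/
def NextNbr {G : SimpleGraph V} (σ : Equiv.Perm G.Dart) (v u w : V) : Prop :=
  ∃ h : G.Adj v u, (σ ⟨(v, u), h⟩).toProd.2 = w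

/-- A minimal counterexample: a plane triangulation admitting no proper 5-coloring with some
color class of size at most `|V|/6`, while every planar graph on fewer vertices admits one. -/
def IsMinimalCounterexample [Fintype V] (G : SimpleGraph V) (σ : Equiv.Perm G.Dart) : Prop :=
  IsPlaneTriangulation G σ ∧
  (¬ ∃ c : V → Fin 5, Proper5 G c ∧
      ∃ k : Fin 5, 6 * Nat.card {v : V | c v = k} ≤ Fintype.card V) ∧
  (∀ (W : Type) [Fintype W] (H : SimpleGraph W), IsPlanar H →
      Fintype.card W < Fintype.card V →
      ∃ c : W → Fin 5, Proper5 H c ∧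
        ∃ k : Fin 5, 6 * Nat.card {w : W | c w = k} ≤ Fintype.card W)

section Helpers

open Classical in
/-- The boundary map from edge functions to vertex functions, mod 2. -/
noncomputable def bdry [Fintype V] (G : SimpleGraph V) :
    (G.edgeSet → ZMod 2) →ₗ[ZMod 2] (V → ZMod 2) where
  toFun z := fun v => ∑ d : G.Dart, if d.fst = v then z ⟨d.edge, d.edge_mem⟩ else 0
  map_add' z z' := by
    funext v
    simp only [Pi.add_apply, ← Finset.sum_add_distrib]
    refine Finset.sum_congr rfl fun d _ => ?_
    split_ifs <;> simp
  map_smul' r z := by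
    funext v
    simp only [Pi.smul_apply, RingHom.id_apply, smul_eq_mul, Finset.mul_sum]
    refine Finset.sum_congr rfl fun d _ => ?_
    split_ifs <;> simp

open Classical in
lemma bdry_single [Fintype V] (G : SimpleGraph V) (a b : V) (h : G.Adj a b) :
    bdry G (Pi.single ⟨s(a, b), h⟩ 1) = Pi.single a 1 + Pi.single b 1 := by
  funext v
  have hne : (⟨(a, b), h⟩ : G.Dart) ≠ ⟨(b, a), h.symm⟩ := by
    intro hh
    have := congrArg (fun d : G.Dart => d.fst) hh
    exact h.ne this
  have key : ∀ d : G.Dart, (if d.fst = v then (Pi.single (⟨s(a, b), h⟩ : G.edgeSet) (1 : ZMod 2) :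
      G.edgeSet → ZMod 2) ⟨d.edge, d.edge_mem⟩ else 0) =
      (if d = ⟨(a, b), h⟩ then (if a = v then 1 else 0) else 0) +
      (if d = ⟨(b, a), h.symm⟩ then (if b = v then 1 else 0) else 0) := by
    intro d
    by_cases h1 : d = ⟨(a, b), h⟩
    · subst h1
      simp [hne, SimpleGraph.Dart.edge]
    · by_cases h2 : d = ⟨(b, a), h.symm⟩
      · subst h2
        simp [hne.symm, SimpleGraph.Dart.edge, Sym2.eq_swap]
      · have : d.edge ≠ s(a, b) := by
          intro he
          have := (SimpleGraph.dart_edge_eq_iff d ⟨(a, b), h⟩).1 he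
          rcases this with h3 | h3
          · exact h1 h3
          · exact h2 h3
        simp only [h1, h2, Pi.single_apply, if_false, add_zero]
        split_ifs with h3 h4
        · exact absurd (congrArg Subtype.val h4) this
        · rfl
        · rfl
  show (∑ d : G.Dart, _) = _
  rw [Finset.sum_congr rfl fun d _ => key d, Finset.sum_add_distrib]
  simp [Pi.single_apply, eq_comm]

lemma zmod2_add_self {α : Type*} (f : α → ZMod 2) : f + f = 0 := by
  funext x
  exact CharTwo.add_self_eq_zero (f x)

open Classical in
lemma walk_chain [Fintype V] (G K : SimpleGraph V) (hK : K ≤ G) (a c : V)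
    (h : K.Reachable a c) : ∃ z : G.edgeSet → ZMod 2, (∀ e, z e ≠ 0 → (e : Sym2 V) ∈ K.edgeSet) ∧
      bdry G z = Pi.single a 1 + Pi.single c 1 := by
  obtain ⟨w⟩ := h
  induction w with
  | nil => exact ⟨0, by simp, by rw [zmod2_add_self, map_zero]⟩
  | @cons a b c hab w ih =>
    obtain ⟨z, hz, hb⟩ := ih
    refine ⟨Pi.single ⟨s(a, b), hK hab⟩ 1 + z, ?_, ?_⟩
    · intro e he
      by_cases h1 : e = ⟨s(a, b), hK hab⟩
      · subst h1
        exact hab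
      · apply hz
        simpa [Pi.single_apply, h1] using he
    · rw [map_add, bdry_single, hb]
      have := zmod2_add_self (Pi.single b 1 : V → ZMod 2)
      calc _ = (Pi.single a 1 + Pi.single c 1 : V → ZMod 2) +
            (Pi.single b 1 + Pi.single b 1) := by abel
        _ = _ := by rw [this, add_zero]

open Classical in
lemma bdry_rank [Fintype V] (G : SimpleGraph V) (hc : G.Connected) :
    Fintype.card V ≤ Module.finrank (ZMod 2) (LinearMap.range (bdry G)) + 1 := by
  obtain ⟨v0⟩ := hc.nonempty
  have htop : LinearMap.range (bdry G) ⊔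
      Submodule.span (ZMod 2) {(Pi.single v0 1 : V → ZMod 2)} = ⊤ := by
    rw [eq_top_iff]
    intro f _
    have hf : f = ∑ u, f u • (Pi.single u 1 : V → ZMod 2) := by
      funext x
      simp [Pi.single_apply]
    rw [hf]
    refine Submodule.sum_mem _ fun u _ => Submodule.smul_mem _ _ ?_
    obtain ⟨z, -, hz⟩ := walk_chain G G le_rfl u v0 (hc.preconnected u v0)
    have : (Pi.single u 1 : V → ZMod 2) = bdry G z + Pi.single v0 1 := by
      rw [hz, add_assoc, zmod2_add_self, add_zero]
    rw [this]
    exact Submodule.add_mem_sup ⟨z, rfl⟩ (Submodule.mem_span_singleton_self _)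
  have h1 := Submodule.finrank_add_le_finrank_add_finrank (LinearMap.range (bdry G))
    (Submodule.span (ZMod 2) {(Pi.single v0 1 : V → ZMod 2)})
  rw [htop, finrank_top, Module.finrank_fintype_fun_eq_card] at h1
  have h2 := finrank_span_le_card (R := ZMod 2) ({(Pi.single v0 1 : V → ZMod 2)} : Set (V → ZMod 2))
  simp at h2
  omega

lemma edge_eq_cases {G : SimpleGraph V} (e : G.edgeSet) :
    ∃ d : G.Dart, (⟨d.edge, d.edge_mem⟩ : G.edgeSet) = e := by
  obtain ⟨e, he⟩ := e
  induction e with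
  | _ a b => exact ⟨⟨(a, b), he⟩, rfl⟩

open Classical in
/-- The map from face functions to edge functions, mod 2. -/
noncomputable def fbdry [Fintype V] {G : SimpleGraph V} (σ : Equiv.Perm G.Dart) :
    (Quotient (orbitSetoid (facePerm σ)) → ZMod 2) →ₗ[ZMod 2] (G.edgeSet → ZMod 2) where
  toFun A := fun e => ∑ d : G.Dart, if d.edge = e then A (Quotient.mk _ d) else 0
  map_add' z z' := by
    funext v
    simp only [Pi.add_apply, ← Finset.sum_add_distrib]
    refine Finset.sum_congr rfl fun d _ => ?_
    split_ifs <;> simp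
  map_smul' r z := by
    funext v
    simp only [Pi.smul_apply, RingHom.id_apply, smul_eq_mul, Finset.mul_sum]
    refine Finset.sum_congr rfl fun d _ => ?_
    split_ifs <;> simp

open Classical in
lemma fbdry_apply [Fintype V] {G : SimpleGraph V} (σ : Equiv.Perm G.Dart)
    (A : Quotient (orbitSetoid (facePerm σ)) → ZMod 2) (d : G.Dart) :
    fbdry σ A ⟨d.edge, d.edge_mem⟩ = A (Quotient.mk _ d) + A (Quotient.mk _ d.symm) := by
  show (∑ d' : G.Dart, _) = _
  rw [← Finset.sum_filter]
  have : (Finset.univ.filter fun d' : G.Dart => d'.edge = d.edge) = {d, d.symm} := by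
    ext d'
    simp [SimpleGraph.dart_edge_eq_iff]
  rw [this, Finset.sum_pair (SimpleGraph.Dart.symm_ne d).symm]

lemma facePerm_mk {G : SimpleGraph V} (σ : Equiv.Perm G.Dart) (d : G.Dart) :
    (Quotient.mk (orbitSetoid (facePerm σ)) (σ d)) = Quotient.mk _ d.symm := by
  apply Quotient.sound
  show (facePerm σ).SameCycle _ _
  have : facePerm σ d.symm = σ d := by
    simp [facePerm, dartRev]
  rw [← this, Equiv.Perm.sameCycle_apply_left]

lemma invariant_orbit {α β : Type*} (f : Equiv.Perm α) (g : α → β) (h : ∀ x, g (f x) = g x)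
    (x y : α) (hxy : f.SameCycle x y) : g x = g y := by
  obtain ⟨i, rfl⟩ := hxy
  have h' : ∀ x, g (f⁻¹ x) = g x := by
    intro x
    rw [← h (f⁻¹ x)]; simp
  induction i using Int.induction_on with
  | zero => simp
  | succ i ih => rw [add_comm, zpow_add, zpow_one, Equiv.Perm.mul_apply, h]; exact ih
  | pred i ih => rw [sub_eq_add_neg, add_comm, zpow_add, zpow_neg_one, Equiv.Perm.mul_apply, h']
                 exact ih

lemma const_of_adj {β : Type*} (G : SimpleGraph V) (g : V → β)
    (h : ∀ x y, G.Adj x y → g x = g y) (x y : V) (hxy : G.Reachable x y) : g x = g y := by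
  obtain ⟨w⟩ := hxy
  induction w with
  | nil => rfl
  | cons hab w ih => rw [h _ _ hab, ih]

open Classical in
lemma fbdry_rank [Fintype V] (G : SimpleGraph V) (σ : Equiv.Perm G.Dart)
    (hT : IsPlaneTriangulation G σ) :
    numFaces σ ≤ Module.finrank (ZMod 2) (LinearMap.range (fbdry σ)) + 1 := by
  have h1 := LinearMap.finrank_range_add_finrank_ker (fbdry σ)
  have hker : LinearMap.ker (fbdry σ) ≤ Submodule.span (ZMod 2) {fun _ => 1} := by
    intro A hA
    have hA' : ∀ d : G.Dart, A (Quotient.mk _ d) = A (Quotient.mk _ d.symm) := by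
      intro d
      have := fbdry_apply σ A d
      rw [LinearMap.mem_ker.1 hA] at this
      exact CharTwo.add_eq_zero.1 this.symm
    have hs : ∀ d : G.Dart, A (Quotient.mk _ (σ d)) = A (Quotient.mk _ d) := by
      intro d
      rw [facePerm_mk, hA' d]
    have hv : ∀ d e : G.Dart, d.fst = e.fst → A (Quotient.mk _ d) = A (Quotient.mk _ e) :=
      fun d e h => invariant_orbit σ (fun d => A (Quotient.mk _ d)) hs d e (hT.rot.orbit_eq d e h)
    let g : V → ZMod 2 := fun v => if h : ∃ d : G.Dart, d.fst = v then
      A (Quotient.mk _ h.choose) else 0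
    have hg : ∀ d : G.Dart, g d.fst = A (Quotient.mk _ d) := by
      intro d
      have h : ∃ e : G.Dart, e.fst = d.fst := ⟨d, rfl⟩
      simp only [g, dif_pos h]
      exact hv _ _ h.choose_spec
    have hgc : ∀ x y, g x = g y := by
      intro x y
      refine const_of_adj G g ?_ x y (hT.connected.preconnected x y)
      intro a b hab
      have e1 := hg ⟨(a, b), hab⟩
      have e2 := hg (SimpleGraph.Dart.symm ⟨(a, b), hab⟩)
      rw [← hA'] at e2
      exact e1.trans e2.symm
    obtain ⟨v0⟩ := hT.connected.nonempty
    rw [Submodule.mem_span_singleton]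
    refine ⟨g v0, ?_⟩
    funext q
    induction q using Quotient.inductionOn with
    | _ d =>
      rw [← hg d, hgc d.fst v0]
      simp
  have h2 := Submodule.finrank_mono hker
  have h3 := finrank_span_le_card (R := ZMod 2)
    ({fun _ => 1} : Set (Quotient (orbitSetoid (facePerm σ)) → ZMod 2))
  rw [Module.finrank_fintype_fun_eq_card] at h1
  simp at h3
  have h4 : numFaces σ = Fintype.card (Quotient (orbitSetoid (facePerm σ))) := by
    rw [numFaces, Nat.card_eq_fintype_card]
  omega

open Classical in
lemma bdry_fbdry [Fintype V] (G : SimpleGraph V) (σ : Equiv.Perm G.Dart)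
    (hT : IsPlaneTriangulation G σ) (A) : bdry G (fbdry σ A) = 0 := by
  funext v
  show (∑ d : G.Dart, _) = _
  simp only [fbdry_apply]
  have h1 : ∀ d : G.Dart, (if d.fst = v then A (Quotient.mk _ d) + A (Quotient.mk _ d.symm) else 0)
      = (if d.fst = v then A (Quotient.mk _ d) else 0) +
        (if (σ d).fst = v then A (Quotient.mk _ (σ d)) else 0) := by
    intro d
    rw [facePerm_mk, hT.rot.fst_eq]
    split_ifs <;> simp
  rw [Finset.sum_congr rfl fun d _ => h1 d, Finset.sum_add_distrib,
    Equiv.sum_comp σ (fun d => if d.fst = v then A (Quotient.mk _ d) else 0)]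
  exact CharTwo.add_self_eq_zero _

open Classical in
/-- Mod 2 exactness: every cycle is a boundary. -/
lemma cycle_is_boundary [Fintype V] (G : SimpleGraph V) (σ : Equiv.Perm G.Dart)
    (hT : IsPlaneTriangulation G σ) (z : G.edgeSet → ZMod 2) (hz : bdry G z = 0) :
    ∃ A : G.Dart → ZMod 2, (∀ d, A (σ d) = A d.symm) ∧
      ∀ d, A d + A d.symm = z ⟨d.edge, d.edge_mem⟩ := by
  have hle : LinearMap.range (fbdry σ) ≤ LinearMap.ker (bdry G) := by
    rintro _ ⟨A, rfl⟩
    exact bdry_fbdry G σ hT A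
  have h1 := LinearMap.finrank_range_add_finrank_ker (bdry G)
  rw [Module.finrank_fintype_fun_eq_card] at h1
  have h2 := bdry_rank G hT.connected
  have h3 := fbdry_rank G σ hT
  have h4 := hT.euler
  rw [Nat.card_eq_fintype_card] at h4
  have heq : LinearMap.range (fbdry σ) = LinearMap.ker (bdry G) :=
    Submodule.eq_of_le_of_finrank_le hle (by omega)
  obtain ⟨A, hA⟩ : z ∈ LinearMap.range (fbdry σ) := by
    rw [heq]; exact hz
  refine ⟨fun d => A (Quotient.mk _ d), fun d => by simp only [facePerm_mk], fun d => ?_⟩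
  rw [← hA, fbdry_apply]
set_option linter.unusedSimpArgs false

lemma exists_pos [Fintype V] {G : SimpleGraph V} (σ : Equiv.Perm G.Dart)
    (hr : IsRotationSystem G σ) (D0 : G.Dart) (x : V) (hx : G.Adj D0.fst x) :
    ∃ i, i < Function.minimalPeriod σ D0 ∧ (σ^[i] D0).snd = x := by
  classical
  have h := hr.orbit_eq D0 ⟨(D0.fst, x), hx⟩ rfl
  obtain ⟨i, hi⟩ := h.exists_nat_pow_eq
  have hp : 0 < Function.minimalPeriod σ D0 := by
    refine Function.IsPeriodicPt.minimalPeriod_pos (n := orderOf σ) (orderOf_pos σ) ?_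
    show σ^[orderOf σ] D0 = D0
    rw [← Equiv.Perm.coe_pow, pow_orderOf_eq_one]; rfl
  refine ⟨i % Function.minimalPeriod σ D0, Nat.mod_lt _ hp, ?_⟩
  rw [Function.iterate_mod_minimalPeriod_eq, ← Equiv.Perm.coe_pow, hi]

lemma iter_fst {G : SimpleGraph V} (σ : Equiv.Perm G.Dart)
    (hr : IsRotationSystem G σ) (D0 : G.Dart) (i : ℕ) : (σ^[i] D0).fst = D0.fst := by
  induction i with
  | zero => rfl
  | succ i ih => rw [Function.iterate_succ_apply', hr.fst_eq, ih]

lemma pos_inj {G : SimpleGraph V} (σ : Equiv.Perm G.Dart)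
    (hr : IsRotationSystem G σ) (D0 : G.Dart) (i j : ℕ) (hi : i < Function.minimalPeriod σ D0)
    (hj : j < Function.minimalPeriod σ D0) (h : (σ^[i] D0).snd = (σ^[j] D0).snd) : i = j := by
  refine Function.iterate_injOn_Iio_minimalPeriod hi hj ?_
  apply SimpleGraph.Dart.ext
  apply Prod.ext
  · exact (iter_fst σ hr D0 i).trans (iter_fst σ hr D0 j).symm
  · exact h

open Classical in
lemma single_edge (G : SimpleGraph V) (e e' : Sym2 V) (he : e ∈ G.edgeSet) (he' : e' ∈ G.edgeSet) :
    (Pi.single (⟨e, he⟩ : G.edgeSet) (1 : ZMod 2) : G.edgeSet → ZMod 2) ⟨e', he'⟩ =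
      if e' = e then 1 else 0 := by
  simp only [Pi.single_apply, Subtype.mk.injEq]

open Classical in
/-- The Jordan-type lemma: two disjoint connections cannot cross around a vertex. -/
lemma no_cross [Fintype V] (G : SimpleGraph V) (σ : Equiv.Perm G.Dart)
    (hT : IsPlaneTriangulation G σ) (D0 : G.Dart) (i : Fin 4 → ℕ) (hi : StrictMono i)
    (hN : ∀ t, i t < Function.minimalPeriod σ D0) (K₁ K₂ : SimpleGraph V) (hK₁ : K₁ ≤ G)
    (hK₂ : K₂ ≤ G) (S₁ S₂ : Set V) (hS₁ : ∀ x y, K₁.Adj x y → x ∈ S₁)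
    (hS₂ : ∀ x y, K₂.Adj x y → x ∈ S₂) (hdis : ∀ x, x ∈ S₁ → x ∉ S₂)
    (hu₁ : D0.fst ∉ S₁) (hu₂ : D0.fst ∉ S₂)
    (ha : (σ^[i 0] D0).snd ∈ S₁) (hc : (σ^[i 2] D0).snd ∈ S₁)
    (hb : (σ^[i 1] D0).snd ∈ S₂)
    (h₁ : K₁.Reachable (σ^[i 0] D0).snd (σ^[i 2] D0).snd)
    (h₂ : K₂.Reachable (σ^[i 1] D0).snd (σ^[i 3] D0).snd) : False := by
  have hr := hT.rot
  have hadj : ∀ t, G.Adj D0.fst (σ^[t] D0).snd := by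
    intro t
    have := (σ^[t] D0).adj
    rwa [show (σ^[t] D0).toProd.1 = D0.fst from iter_fst σ hr D0 t] at this
  set u := D0.fst with hu
  set a := (σ^[i 0] D0).snd with ha'
  set c := (σ^[i 2] D0).snd with hc'
  obtain ⟨z₀, hz₀, hbz₀⟩ := walk_chain G K₁ hK₁ a c h₁
  let z : G.edgeSet → ZMod 2 :=
    z₀ + (Pi.single ⟨s(u, a), hadj _⟩ 1 + Pi.single ⟨s(u, c), hadj _⟩ 1)
  have hzval : ∀ (e : Sym2 V) (he : e ∈ G.edgeSet), z ⟨e, he⟩ = z₀ ⟨e, he⟩ +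
      ((if e = s(u, a) then 1 else 0) + (if e = s(u, c) then 1 else 0)) := by
    intro e he
    rw [← single_edge G s(u, a) e (hadj _) he, ← single_edge G s(u, c) e (hadj _) he]
    rfl
  have hz : bdry G z = 0 := by
    simp only [z, map_add, bdry_single, hbz₀]
    have e1 := zmod2_add_self (Pi.single u 1 : V → ZMod 2)
    have e2 := zmod2_add_self (Pi.single a 1 : V → ZMod 2)
    have e3 := zmod2_add_self (Pi.single c 1 : V → ZMod 2)
    calc _ = (Pi.single u 1 + Pi.single u 1 : V → ZMod 2) + (Pi.single a 1 + Pi.single a 1) +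
          (Pi.single c 1 + Pi.single c 1) := by abel
      _ = 0 := by rw [e1, e2, e3]; simp
  obtain ⟨A, hA1, hA2⟩ := cycle_is_boundary G σ hT z hz
  -- support of the path part
  have hz₀' : ∀ d : G.Dart, d.fst ∉ S₁ → z₀ ⟨d.edge, d.edge_mem⟩ = 0 := by
    intro d hd
    by_contra hne
    have h := hz₀ _ hne
    have h' : K₁.Adj d.fst d.snd := h
    exact hd (hS₁ _ _ h')
  have hstep : ∀ d, A (σ d) = A d + z ⟨d.edge, d.edge_mem⟩ := by
    intro d
    rw [hA1, ← hA2, ← add_assoc, CharTwo.add_self_eq_zero, zero_add]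
  -- vanishing at vertices of the second set
  have hz2 : ∀ d : G.Dart, d.fst ∈ S₂ → z ⟨d.edge, d.edge_mem⟩ = 0 := by
    intro d hd
    have h1 := hz₀' d (fun h => hdis _ h hd)
    have hne : ∀ x, x ∈ S₁ → d.edge ≠ s(u, x) := by
      intro x hx he
      have : d.fst ∈ (s(u, x) : Sym2 V) := by
        rw [← he]
        exact Sym2.mem_mk_left _ _
      rcases Sym2.mem_iff.1 this with h | h
      · exact hu₂ (h ▸ hd)
      · exact hdis _ hx (h ▸ hd)
    simp only [hzval, h1, hne a ha, hne c hc, if_false, add_zero]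
  have hconst : ∀ d e : G.Dart, d.fst = e.fst → d.fst ∈ S₂ → A d = A e := by
    intro d e hde hd
    have := invariant_orbit σ (fun x : G.Dart => if x.fst ∈ S₂ then A x else 0) ?_ d e
      (hr.orbit_eq d e hde)
    · simpa [← hde, hd] using this
    · intro x
      simp only [hr.fst_eq]
      split_ifs with hx
      · rw [hstep, hz2 x hx, add_zero]
      · rfl
  have hsymm : ∀ d : G.Dart, d.fst ∈ S₂ → A d = A d.symm := by
    intro d hd
    have := hA2 d
    rw [hz2 d hd] at this
    exact CharTwo.add_eq_zero.1 this
  -- constancy along the second chain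
  have hprop : ∀ x y, K₂.Reachable x y → x ∈ S₂ → y ∈ S₂ ∧
      ∀ d e : G.Dart, d.fst = x → e.fst = y → A d = A e := by
    intro x y ⟨w⟩
    induction w with
    | nil => intro hx; exact ⟨hx, fun d e hd he => hconst d e (hd.trans he.symm) (hd ▸ hx)⟩
    | @cons x y t hxy w ih =>
      intro hx
      have hy : y ∈ S₂ := hS₂ _ _ hxy.symm
      obtain ⟨ht, hh⟩ := ih hy
      refine ⟨ht, fun d e hd he => ?_⟩
      let f : G.Dart := ⟨(x, y), hK₂ hxy⟩
      rw [hconst d f hd (hd ▸ hx), hsymm f hx]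
      exact hh _ _ rfl he
  obtain ⟨hd, hAe⟩ := hprop _ _ h₂ hb
  have hsf : ∀ t, (σ^[t] D0).symm.fst = (σ^[t] D0).snd := fun t => rfl
  have hA13 : A (σ^[i 1] D0) = A (σ^[i 3] D0) := by
    have e := hAe (σ^[i 1] D0).symm (σ^[i 3] D0).symm rfl rfl
    have e1 := hsymm (σ^[i 1] D0).symm hb
    have e3 := hsymm (σ^[i 3] D0).symm hd
    rw [SimpleGraph.Dart.symm_symm] at e1 e3
    rw [← e1, ← e3, e]
  -- values around u
  have hzu : ∀ s, s < Function.minimalPeriod σ D0 →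
      z ⟨(σ^[s] D0).edge, (σ^[s] D0).edge_mem⟩ = (if s = i 0 then 1 else 0) +
        (if s = i 2 then 1 else 0) := by
    intro s hs
    have h1 := hz₀' (σ^[s] D0) (by rw [iter_fst σ hr]; exact hu₁)
    have hedge : (σ^[s] D0).edge = s(u, (σ^[s] D0).snd) := by
      rw [hu, ← iter_fst σ hr D0 s]; rfl
    have hcase : ∀ t : Fin 4, (σ^[s] D0).edge = s(u, (σ^[i t] D0).snd) ↔ s = i t := by
      intro t
      rw [hedge, Sym2.congr_right]
      constructor
      · exact fun h => pos_inj σ hr D0 _ _ hs (hN t) h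
      · rintro rfl; rfl
    simp only [hzval, h1, zero_add]
    simp only [a, c, hcase]
  have hval : ∀ t, t < Function.minimalPeriod σ D0 → A (σ^[t] D0) = A D0 +
      ((if i 0 < t then 1 else 0) + (if i 2 < t then 1 else 0)) := by
    intro t
    induction t with
    | zero => intro _; simp
    | succ t ih =>
      intro ht
      rw [Function.iterate_succ_apply', hstep, ih (by omega), hzu t (by omega)]
      have h02 : i 0 < i 2 := hi (by decide)
      rcases lt_trichotomy t (i 0) with h | h | h
      · simp [show ¬ i 0 < t by omega, show ¬ i 2 < t by omega, show ¬ i 0 < t + 1 by omega,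
          show ¬ i 2 < t + 1 by omega, show t ≠ i 0 by omega, show t ≠ i 2 by omega]
      · simp [show ¬ i 0 < t by omega, show ¬ i 2 < t by omega, show i 0 < t + 1 by omega,
          show ¬ i 2 < t + 1 by omega, show t = i 0 by omega, show i 0 ≠ i 2 by omega,
          show ¬ i 2 < i 0 by omega, show ¬ i 2 < i 0 + 1 by omega]
      · rcases lt_trichotomy t (i 2) with h' | h' | h'
        · simp [show i 0 < t by omega, show ¬ i 2 < t by omega, show i 0 < t + 1 by omega,
            show ¬ i 2 < t + 1 by omega, show t ≠ i 0 by omega, show t ≠ i 2 by omega]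
        · subst h'
          simp [show i 0 < i 2 by omega, show i 0 < i 2 + 1 by omega,
            show i 2 ≠ i 0 by omega, add_assoc]
        · simp [show i 0 < t by omega, show i 2 < t by omega, show i 0 < t + 1 by omega,
            show i 2 < t + 1 by omega, show t ≠ i 0 by omega, show t ≠ i 2 by omega]
  have h01 : i 0 < i 1 := hi (by decide)
  have h12 : i 1 < i 2 := hi (by decide)
  have h23 : i 2 < i 3 := hi (by decide)
  rw [hval _ (hN 1), hval _ (hN 3)] at hA13
  simp [show i 0 < i 1 by omega, show ¬ i 2 < i 1 by omega, show i 0 < i 3 by omega,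
    show i 2 < i 3 by omega] at hA13

/-- A coloring is proper on the set `X`. -/
def ProperOn (G : SimpleGraph V) (c : V → Fin 5) (X : Set V) : Prop :=
  ∀ x ∈ X, ∀ y ∈ X, G.Adj x y → c x ≠ c y

/-- The graph whose components are the Kempe chains in colors `p`, `q` inside `X`. -/
def kempe (G : SimpleGraph V) (c : V → Fin 5) (X : Set V) (p q : Fin 5) : SimpleGraph V where
  Adj x y := G.Adj x y ∧ x ∈ X ∧ y ∈ X ∧ (c x = p ∨ c x = q) ∧ (c y = p ∨ c y = q)
  symm := ⟨fun _ _ h => ⟨h.1.symm, h.2.2.1, h.2.1, h.2.2.2.2, h.2.2.2.1⟩⟩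
  loopless := ⟨fun _ h => h.1.ne rfl⟩

lemma kempe_reach (G : SimpleGraph V) (c : V → Fin 5) (X : Set V) (p q : Fin 5) (n x : V)
    (hn : c n = p) (h : (kempe G c X p q).Reachable n x) : c x = p ∨ c x = q := by
  obtain ⟨w⟩ := h.symm
  cases w with
  | nil => exact Or.inl hn
  | cons h _ => exact h.2.2.2.1

open Classical in
lemma kempe_swap (G : SimpleGraph V) (c : V → Fin 5) (X : Set V) (p q k : Fin 5) (n : V)
    (hP : ProperOn G c X) (hn : c n = p) (hkp : k ≠ p) (hkq : k ≠ q) :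
    ∃ c' : V → Fin 5, ProperOn G c' X ∧ (∀ x, c' x = k ↔ c x = k) ∧ c' n = q ∧
      (∀ x, c x ≠ p → c x ≠ q → c' x = c x) ∧
      (∀ x, ¬ (kempe G c X p q).Reachable n x → c' x = c x) := by
  refine ⟨fun x => if (kempe G c X p q).Reachable n x then Equiv.swap p q (c x) else c x,
    ?_, ?_, ?_, ?_, ?_⟩
  · have mixed : ∀ x ∈ X, ∀ y ∈ X, G.Adj x y → (kempe G c X p q).Reachable n x →
        ¬ (kempe G c X p q).Reachable n y → Equiv.swap p q (c x) ≠ c y := by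
      intro x hx y hy hxy h1 h2 heq
      have hcx := kempe_reach G c X p q n x hn h1
      have hcy : c y = p ∨ c y = q := by
        rw [← heq]
        rcases hcx with h | h <;> simp [h]
      refine h2 (h1.trans (SimpleGraph.Adj.reachable ?_))
      exact ⟨hxy, hx, hy, hcx, hcy⟩
    intro x hx y hy hxy
    simp only
    split_ifs with h1 h2 h2
    · exact fun h => hP x hx y hy hxy ((Equiv.swap p q).injective h)
    · exact mixed x hx y hy hxy h1 h2
    · exact (mixed y hy x hx hxy.symm h2 h1).symm
    · exact hP x hx y hy hxy
  · intro x
    simp only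
    split_ifs with h1
    · constructor
      · intro h
        have := congrArg (Equiv.swap p q) h
        rwa [Equiv.swap_apply_self, Equiv.swap_apply_of_ne_of_ne hkp hkq] at this
      · intro h
        rw [h, Equiv.swap_apply_of_ne_of_ne hkp hkq]
    · rfl
  · simp [hn]
  · intro x h1 h2
    simp only
    split_ifs with h
    · exact Equiv.swap_apply_of_ne_of_ne h1 h2
    · rfl
  · intro x h
    simp [h]

open Classical in
lemma extend_color (G : SimpleGraph V) (c : V → Fin 5) (X : Set V) (u : V) (j : Fin 5)
    (hu : u ∉ X) (hP : ProperOn G c X) (hj : ∀ x ∈ X, G.Adj u x → c x ≠ j) :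
    ∃ c' : V → Fin 5, ProperOn G c' (insert u X) ∧ (∀ x ∈ X, c' x = c x) ∧ c' u = j := by
  have hne : ∀ x ∈ X, x ≠ u := fun x hx h => hu (h ▸ hx)
  refine ⟨Function.update c u j, ?_, ?_, by simp⟩
  · intro x hx y hy hxy
    rcases hx with rfl | hx <;> rcases hy with rfl | hy
    · exact absurd rfl hxy.ne
    · simpa [Function.update_of_ne (hne y hy)] using (hj y hy hxy).symm
    · simpa [Function.update_of_ne (hne x hx)] using (hj x hx hxy.symm)
    · simpa [Function.update_of_ne (hne y hy), Function.update_of_ne (hne x hx)] using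
        hP x hx y hy hxy
  · intro x hx
    simp [Function.update_of_ne (hne x hx)]

open Classical in
/-- Kempe-chain extension. -/
lemma extend_free [Fintype V] (G : SimpleGraph V) (σ : Equiv.Perm G.Dart)
    (hT : IsPlaneTriangulation G σ) (c : V → Fin 5) (X : Set V) (k : Fin 5) (u : V)
    (hu : u ∉ X) (hP : ProperOn G c X)
    (hN : (Finset.univ.filter fun x => G.Adj u x ∧ x ∈ X ∧ c x ≠ k).card ≤ 4) :
    ∃ c' : V → Fin 5, ProperOn G c' (insert u X) ∧ (∀ x ∈ X, (c' x = k ↔ c x = k)) ∧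
      c' u ≠ k := by
  by_cases hfree : ∃ j, j ≠ k ∧ ∀ x ∈ X, G.Adj u x → c x ≠ j
  · obtain ⟨j, hjk, hj⟩ := hfree
    obtain ⟨c', h1, h2, h3⟩ := extend_color G c X u j hu hP hj
    exact ⟨c', h1, fun x hx => by rw [h2 x hx], by rw [h3]; exact hjk⟩
  push Not at hfree
  set N := Finset.univ.filter fun x => G.Adj u x ∧ x ∈ X ∧ c x ≠ k with hNdef
  have hmem : ∀ x, x ∈ N ↔ G.Adj u x ∧ x ∈ X ∧ c x ≠ k := by
    intro x; simp [hNdef]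
  have himg : N.image c = Finset.univ.erase k := by
    ext j
    simp only [Finset.mem_image, Finset.mem_erase, Finset.mem_univ, and_true]
    constructor
    · rintro ⟨x, hx, rfl⟩
      exact ((hmem x).1 hx).2.2
    · intro hj
      obtain ⟨x, hx, hux, hc⟩ := hfree j hj
      exact ⟨x, (hmem x).2 ⟨hux, hx, by rw [hc]; exact hj⟩, hc⟩
  have hcard4 : (N.image c).card = 4 := by rw [himg]; simp
  have hNcard : N.card = 4 := le_antisymm hN (hcard4 ▸ Finset.card_image_le)
  have hinj : Set.InjOn c N := Finset.card_image_iff.1 (hcard4.trans hNcard.symm)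
  have hr := hT.rot
  obtain ⟨x0, hx0⟩ : N.Nonempty := Finset.card_pos.1 (by omega)
  let D0 : G.Dart := ⟨(u, x0), ((hmem x0).1 hx0).1⟩
  let nb : ℕ → V := fun i => (σ^[i] D0).snd
  let P := (Finset.range (Function.minimalPeriod σ D0)).filter fun i => nb i ∈ N
  have hPimg : P.image nb = N := by
    ext x
    simp only [P, Finset.mem_image, Finset.mem_filter, Finset.mem_range]
    constructor
    · rintro ⟨i, ⟨_, hi⟩, rfl⟩; exact hi
    · intro hx
      obtain ⟨i, hi, hix⟩ := exists_pos σ hr D0 x ((hmem x).1 hx).1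
      exact ⟨i, ⟨hi, by show (σ^[i] D0).snd ∈ N; rw [hix]; exact hx⟩, hix⟩
  have hPinj : Set.InjOn nb P := by
    intro i hi j hj hij
    simp only [P, Finset.coe_filter, Finset.mem_range, Set.mem_ofPred_eq] at hi hj
    exact pos_inj σ hr D0 i j hi.1 hj.1 hij
  have hPcard : P.card = 4 := by
    rw [← hNcard, ← hPimg, Finset.card_image_of_injOn hPinj]
  let i := P.orderEmbOfFin hPcard
  have hiP : ∀ t, i t ∈ P := fun t => Finset.orderEmbOfFin_mem P hPcard t
  have hilt : ∀ t, i t < Function.minimalPeriod σ D0 := fun t => by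
    have := hiP t
    simp only [P, Finset.mem_filter, Finset.mem_range] at this
    exact this.1
  have hnN : ∀ t, nb (i t) ∈ N := fun t => by
    have := hiP t
    simp only [P, Finset.mem_filter, Finset.mem_range] at this
    exact this.2
  have hsurj : ∀ x ∈ N, ∃ t, nb (i t) = x := by
    intro x hx
    rw [← hPimg, Finset.mem_image] at hx
    obtain ⟨j, hj, hjx⟩ := hx
    have : j ∈ Set.range i := by
      rw [Finset.range_orderEmbOfFin]; exact hj
    obtain ⟨t, rfl⟩ := this
    exact ⟨t, hjx⟩
  have hpinj : ∀ s t, c (nb (i s)) = c (nb (i t)) → s = t := by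
    intro s t h
    have h1 := hinj (hnN s) (hnN t) h
    have h2 := hPinj (hiP s) (hiP t) h1
    exact i.injective h2
  have hk : ∀ t, k ≠ c (nb (i t)) := fun t => ((hmem _).1 (hnN t)).2.2.symm
  have hX : ∀ t, nb (i t) ∈ X := fun t => ((hmem _).1 (hnN t)).2.1
  have hsub : ∀ s t, s ≠ t → ¬ (kempe G c X (c (nb (i s))) (c (nb (i t)))).Reachable
      (nb (i s)) (nb (i t)) → ∃ c' : V → Fin 5, ProperOn G c' (insert u X) ∧
      (∀ x ∈ X, (c' x = k ↔ c x = k)) ∧ c' u ≠ k := by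
    intro s t hst hnr
    obtain ⟨c₁, h1, h2, h3, h4, h5⟩ := kempe_swap G c X (c (nb (i s))) (c (nb (i t))) k (nb (i s))
      hP rfl (hk s) (hk t)
    obtain ⟨c', g1, g2, g3⟩ := extend_color G c₁ X u (c (nb (i s))) hu h1 (by
      intro x hx hux hcx
      have hxk : c x ≠ k := fun h => hk s (by rw [← hcx]; exact ((h2 x).2 h).symm)
      obtain ⟨r, rfl⟩ := hsurj x ((hmem x).2 ⟨hux, hx, hxk⟩)
      by_cases hrs : r = s
      · subst hrs
        rw [h3] at hcx
        exact hst (hpinj _ _ hcx.symm)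
      · by_cases hrt : r = t
        · subst hrt
          rw [h5 _ hnr] at hcx
          exact hst (hpinj _ _ hcx.symm)
        · rw [h4 _ (fun h => hrs (hpinj _ _ h)) (fun h => hrt (hpinj _ _ h))] at hcx
          exact hrs (hpinj _ _ hcx))
    exact ⟨c', g1, fun x hx => by rw [g2 x hx]; exact h2 x, by rw [g3]; exact (hk s).symm⟩
  by_cases h02 : (kempe G c X (c (nb (i 0))) (c (nb (i 2)))).Reachable (nb (i 0)) (nb (i 2))
  swap
  · exact hsub 0 2 (by decide) h02
  by_cases h13 : (kempe G c X (c (nb (i 1))) (c (nb (i 3)))).Reachable (nb (i 1)) (nb (i 3))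
  swap
  · exact hsub 1 3 (by decide) h13
  exfalso
  refine no_cross G σ hT D0 i i.strictMono hilt
    (kempe G c X (c (nb (i 0))) (c (nb (i 2)))) (kempe G c X (c (nb (i 1))) (c (nb (i 3)))) (fun _ _ h => h.1) (fun _ _ h => h.1)
    {x | x ∈ X ∧ (c x = c (nb (i 0)) ∨ c x = c (nb (i 2)))}
    {x | x ∈ X ∧ (c x = c (nb (i 1)) ∨ c x = c (nb (i 3)))}
    (fun x y h => ⟨h.2.1, h.2.2.2.1⟩) (fun x y h => ⟨h.2.1, h.2.2.2.1⟩) ?_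
    (fun h => hu h.1) (fun h => hu h.1) ⟨hX 0, Or.inl rfl⟩ ⟨hX 2, Or.inr rfl⟩ ⟨hX 1, Or.inl rfl⟩
    h02 h13
  rintro x ⟨_, h1⟩ ⟨_, h2⟩
  rcases h1 with h1 | h1 <;> rcases h2 with h2 | h2 <;>
    exact absurd (hpinj _ _ (h1.symm.trans h2)) (by decide)

open Classical in
lemma deg_eq_card [Fintype V] (G : SimpleGraph V) (v : V) :
    deg G v = (Finset.univ.filter fun x => G.Adj v x).card := by
  rw [deg, Nat.card_eq_fintype_card, ← Fintype.card_subtype]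
  exact Fintype.card_congr (Equiv.refl _)

open Classical in
lemma extend_many [Fintype V] (G : SimpleGraph V) (σ : Equiv.Perm G.Dart)
    (hT : IsPlaneTriangulation G σ) (k : Fin 5) (r : V → ℕ) (m : ℕ) :
    ∀ (Y : Finset V) (X : Set V) (c : V → Fin 5), Y.card = m → (∀ y ∈ Y, y ∉ X) →
      ProperOn G c X → (∀ y ∈ Y, deg G y = 5) →
      (∀ y ∈ Y, (∃ x ∈ X, G.Adj y x ∧ c x = k) ∨
        (∃ y', G.Adj y y' ∧ y' ∉ X ∧ (y' ∉ Y ∨ r y' < r y))) →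
      ∃ c' : V → Fin 5, ProperOn G c' (X ∪ Y) ∧ (∀ x ∈ X, (c' x = k ↔ c x = k)) ∧
        ∀ y ∈ Y, c' y ≠ k := by
  induction m with
  | zero =>
    intro Y X c hY _ hP _ _
    rw [Finset.card_eq_zero] at hY
    subst hY
    exact ⟨c, by simpa using hP, by simp, by simp⟩
  | succ m ih =>
    intro Y X c hY hYX hP hdeg hgood
    obtain ⟨y, hy, hmax⟩ := Finset.exists_max_image Y r (Finset.card_pos.1 (by omega))
    have hx0 : ∃ x0, G.Adj y x0 ∧ ¬ (x0 ∈ X ∧ c x0 ≠ k) := by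
      rcases hgood y hy with ⟨x, hx, h1, h2⟩ | ⟨y', h1, h2, _⟩
      · exact ⟨x, h1, fun h => h.2 h2⟩
      · exact ⟨y', h1, fun h => h2 h.1⟩
    obtain ⟨x0, hyx0, hx0⟩ := hx0
    have hcard : (Finset.univ.filter fun x => G.Adj y x ∧ x ∈ X ∧ c x ≠ k).card ≤ 4 := by
      have hsub : (Finset.univ.filter fun x => G.Adj y x ∧ x ∈ X ∧ c x ≠ k) ⊆
          (Finset.univ.filter fun x => G.Adj y x).erase x0 := by
        intro x hx
        simp only [Finset.mem_filter, Finset.mem_univ, true_and, Finset.mem_erase] at hx ⊢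
        exact ⟨fun h => hx0 (h ▸ hx.2), hx.1⟩
      refine (Finset.card_le_card hsub).trans ?_
      rw [Finset.card_erase_of_mem (by simpa using hyx0), ← deg_eq_card, hdeg y hy]
    obtain ⟨c₁, h1, h2, h3⟩ := extend_free G σ hT c X k y (hYX y hy) hP hcard
    obtain ⟨c', g1, g2, g3⟩ := ih (Y.erase y) (insert y X) c₁
      (by rw [Finset.card_erase_of_mem hy, hY]; rfl)
      (by
        intro w hw hw'
        rw [Finset.mem_erase] at hw
        rcases hw' with h | h
        · exact hw.1 h
        · exact hYX w hw.2 h) h1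
      (fun w hw => hdeg w (Finset.mem_of_mem_erase hw))
      (by
        intro w hw
        rw [Finset.mem_erase] at hw
        rcases hgood w hw.2 with ⟨x, hx, e1, e2⟩ | ⟨y', e1, e2, e3⟩
        · exact Or.inl ⟨x, Or.inr hx, e1, (h2 x hx).2 e2⟩
        · refine Or.inr ⟨y', e1, ?_, ?_⟩
          · rintro (h | h)
            · subst h
              rcases e3 with e3 | e3
              · exact e3 hy
              · exact absurd (hmax w hw.2) (by omega)
            · exact e2 h
          · rcases e3 with e3 | e3
            · exact Or.inl fun h => e3 (Finset.mem_of_mem_erase h)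
            · exact Or.inr e3)
    refine ⟨c', ?_, ?_, ?_⟩
    · have : X ∪ (Y : Set V) = insert y X ∪ ((Y.erase y : Finset V) : Set V) := by
        ext w
        simp only [Set.mem_union, Set.mem_insert_iff, Finset.mem_coe, Finset.mem_erase]
        by_cases hw : w = y
        · subst hw; simp [hy]
        · simp [hw]
      rw [this]; exact g1
    · intro x hx
      rw [g2 x (Or.inr hx), h2 x hx]
    · intro w hw
      by_cases hwy : w = y
      · subst hwy
        intro h
        exact h3 ((g2 w (Or.inl rfl)).1 h)
      · exact g3 w (Finset.mem_erase.2 ⟨hwy, hw⟩)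

lemma next_adj [Fintype V] (G : SimpleGraph V) (σ : Equiv.Perm G.Dart)
    (hT : IsPlaneTriangulation G σ) (e : G.Dart) : G.Adj e.snd (σ e).snd := by
  classical
  have hr := hT.rot
  set f := facePerm σ with hf
  have hf' : ∀ d, f d = σ d.symm := fun d => rfl
  set d0 := e.symm with hd0
  have h1 : f d0 = σ e := by rw [hf', hd0, SimpleGraph.Dart.symm_symm]
  have hmoved : f d0 ≠ d0 := by
    intro h
    have h2 := congrArg (fun d : G.Dart => d.fst) (h1.symm.trans h)
    simp only [hr.fst_eq] at h2
    exact e.adj.ne h2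
  have hcard : (f.cycleOf d0).support.card = 3 := by
    rw [← hT.face_size_eq d0, faceSize, Nat.card_eq_fintype_card, Fintype.card_subtype]
    congr 1
    ext x
    simp only [Finset.mem_filter, Finset.mem_univ, true_and]
    rw [Equiv.Perm.mem_support_cycleOf_iff]
    simp only [Equiv.Perm.mem_support]
    exact ⟨fun h => h.1, fun h => ⟨h, hmoved⟩⟩
  have h3 : (f ^ 3) d0 = d0 := by
    have := Equiv.Perm.pow_mod_card_support_cycleOf_self_apply f 3 d0
    rw [hcard] at this
    simpa using this.symm
  have h4 : f (f (f d0)) = d0 := h3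
  have h5 : (f (f (f d0))).fst = (f (f d0)).snd := by
    rw [hf' (f (f d0)), hr.fst_eq]; rfl
  have h6 : (f (f d0)).fst = (f d0).snd := by
    rw [hf' (f d0), hr.fst_eq]; rfl
  have h7 := (f (f d0)).adj
  have h8 : (f (f d0)).toProd.2 = e.snd := by
    rw [← h5, h4]; rfl
  rw [h8, h6, h1] at h7
  exact h7.symm

open Classical in
/-- The combinatorial core: positions around `v`. -/
lemma order_around [Fintype V] (G : SimpleGraph V) (σ : Equiv.Perm G.Dart)
    (hT : IsPlaneTriangulation G σ) (v w0 : V) (hw0 : G.Adj v w0) (W U : Finset V)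
    (hUW : ∀ x, G.Adj v x → (x ∈ U ↔ x ∉ W)) (hUv : ∀ x ∈ U, G.Adj v x)
    (hw0W : w0 ∈ W) (hW : W.card ≤ 3) :
    ∃ (r : V → ℕ) (ys : V), ∀ y ∈ U, y ≠ ys → G.Adj y w0 ∨
      ∃ y' ∈ U, G.Adj y y' ∧ r y' < r y := by
  have hr := hT.rot
  let D0 : G.Dart := ⟨(v, w0), hw0⟩
  let N := Function.minimalPeriod σ D0
  let nb : ℕ → V := fun i => (σ^[i] D0).snd
  have hnb0 : nb 0 = w0 := rfl
  have hnbN : nb N = w0 := by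
    show (σ^[N] D0).snd = w0
    rw [Function.iterate_minimalPeriod]
  have hvadj : ∀ i, G.Adj v (nb i) := by
    intro i
    have := (σ^[i] D0).adj
    rwa [show (σ^[i] D0).toProd.1 = v from iter_fst σ hr D0 i] at this
  have hnext : ∀ i, G.Adj (nb i) (nb (i + 1)) := by
    intro i
    have := next_adj G σ hT (σ^[i] D0)
    rwa [← Function.iterate_succ_apply' σ i D0] at this
  have hinj : ∀ i j, i < N → j < N → nb i = nb j → i = j :=
    fun i j hi hj h => pos_inj σ hr D0 i j hi hj h
  have hNpos : 0 < N := by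
    obtain ⟨i, hi, _⟩ := exists_pos σ hr D0 w0 hw0
    exact lt_of_le_of_lt (Nat.zero_le i) hi
  have hex : ∀ x, ∃ i, G.Adj v x → i < N ∧ nb i = x := by
    intro x
    by_cases hx : G.Adj v x
    · obtain ⟨i, hi⟩ := exists_pos σ hr D0 x hx
      exact ⟨i, fun _ => hi⟩
    · exact ⟨0, fun h => absurd h hx⟩
  choose pos hpos using hex
  have hposnb : ∀ i, i < N → pos (nb i) = i := fun i hi =>
    hinj _ _ (hpos _ (hvadj i)).1 hi (hpos _ (hvadj i)).2
  -- the first later position carrying a vertex of `W`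
  have hpex : ∃ p, 0 < p ∧ nb p ∈ W := ⟨N, hNpos, by rw [hnbN]; exact hw0W⟩
  let p := Nat.find hpex
  have hp : 0 < p ∧ nb p ∈ W := Nat.find_spec hpex
  have hpmin : ∀ i, 0 < i → i < p → nb i ∉ W := fun i h1 h2 h3 => Nat.find_min hpex h2 ⟨h1, h3⟩
  have hpN : p ≤ N := Nat.find_min' hpex ⟨hNpos, by rw [hnbN]; exact hw0W⟩
  have huniq : ∀ q q', p < q → q < q' → q' < N → nb q ∈ W → nb q' ∈ W → False := by
    intro q q' h1 h2 h3 hq hq'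
    have hsub : ({0, p, q, q'} : Finset ℕ).image nb ⊆ W := by
      intro x hx
      simp only [Finset.mem_image, Finset.mem_insert, Finset.mem_singleton] at hx
      obtain ⟨i, hi, rfl⟩ := hx
      rcases hi with rfl | rfl | rfl | rfl
      · exact hw0W
      · exact hp.2
      · exact hq
      · exact hq'
    have hc := Finset.card_le_card hsub
    rw [Finset.card_image_of_injOn] at hc
    · have : ({0, p, q, q'} : Finset ℕ).card = 4 := by
        have := hp.1
        rw [Finset.card_insert_of_notMem, Finset.card_insert_of_notMem,
          Finset.card_insert_of_notMem, Finset.card_singleton]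
        · simp only [Finset.mem_singleton]; omega
        · simp only [Finset.mem_insert, Finset.mem_singleton]; omega
        · simp only [Finset.mem_insert, Finset.mem_singleton]; omega
      omega
    · intro i hi j hj h
      simp only [Finset.coe_insert, Finset.coe_singleton, Set.mem_insert_iff,
        Set.mem_singleton_iff] at hi hj
      exact hinj i j (by omega) (by omega) h
  have hys : ∃ ys : V, ∀ i, p < i → i + 1 < N → nb (i + 1) ∈ W → nb i = ys := by
    by_cases hq : ∃ i, p < i ∧ i + 1 < N ∧ nb (i + 1) ∈ W
    · obtain ⟨i, h1, h2, h3⟩ := hq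
      refine ⟨nb i, fun j g1 g2 g3 => ?_⟩
      rcases lt_trichotomy i j with h | h | h
      · exact (huniq (i + 1) (j + 1) (by omega) (by omega) g2 h3 g3).elim
      · rw [h]
      · exact (huniq (j + 1) (i + 1) (by omega) (by omega) h2 g3 h3).elim
    · exact ⟨v, fun i g1 g2 g3 => absurd ⟨i, g1, g2, g3⟩ hq⟩
  obtain ⟨ys, hys⟩ := hys
  refine ⟨fun x => if pos x < p then pos x else N - pos x, ys, ?_⟩
  intro y hy hne
  obtain ⟨hiN, hi⟩ := hpos y (hUv y hy)
  set i := pos y with hidef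
  have hyW : nb i ∉ W := by rw [hi]; exact (hUW y (hUv y hy)).1 hy
  have hi0 : i ≠ 0 := by
    intro h
    rw [h, hnb0] at hyW
    exact hyW hw0W
  have hip : i ≠ p := by
    intro h
    rw [h] at hyW
    exact hyW hp.2
  rcases lt_or_gt_of_ne hip with hlt | hgt
  · obtain ⟨j, hj⟩ : ∃ j, i = j + 1 := ⟨i - 1, by omega⟩
    have hadj : G.Adj y (nb j) := by
      have := hnext j
      rw [← hj, hi] at this
      exact this.symm
    by_cases hj0 : j = 0
    · left
      rw [hj0, hnb0] at hadj
      exact hadj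
    · right
      refine ⟨nb j, (hUW _ (hvadj j)).2 (hpmin j (by omega) (by omega)), hadj, ?_⟩
      have e := hposnb j (by omega)
      simp only [e, ← hidef]
      rw [if_pos (by omega), if_pos (by omega)]
      omega
  · have hadj : G.Adj y (nb (i + 1)) := by
      have := hnext i
      rwa [hi] at this
    by_cases hjN : i + 1 = N
    · left
      rw [hjN, hnbN] at hadj
      exact hadj
    · right
      have hjW : nb (i + 1) ∉ W := fun h => hne (by rw [← hi]; exact hys i hgt (by omega) h)
      refine ⟨nb (i + 1), (hUW _ (hvadj _)).2 hjW, hadj, ?_⟩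
      have e := hposnb (i + 1) (by omega)
      simp only [e, ← hidef]
      rw [if_neg (by omega), if_neg (by omega)]
      omega

open Classical in
lemma main_contra [Fintype V] (G : SimpleGraph V) (σ : Equiv.Perm G.Dart)
    (hG : IsMinimalCounterexample G σ) (v : V) (U W : Finset V)
    (hU : ∀ x, x ∈ U ↔ G.Adj v x ∧ deg G x = 5) (hW : ∀ x, x ∈ W ↔ G.Adj v x ∧ deg G x ≠ 5)
    (hUc : 5 ≤ U.card) (hWc : W.card ≤ 3) : False := by
  obtain ⟨hT, hno, hmin⟩ := hG
  have hvU : v ∉ U := fun h => ((hU v).1 h).1.ne rfl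
  let X : Set V := {x | x ∉ insert v U}
  have hXcard : Fintype.card X = Fintype.card V - (U.card + 1) := by
    rw [← Finset.card_insert_of_notMem hvU, ← Finset.card_compl, Fintype.card_of_subtype]
    intro x
    rw [Finset.mem_compl]
    rfl
  have hle : U.card + 1 ≤ Fintype.card V := by
    rw [← Finset.card_insert_of_notMem hvU]
    exact Finset.card_le_univ _
  have hplanar : IsPlanar (G.induce X) :=
    ⟨V, inferInstance, G, σ, hT, (SimpleGraph.Embedding.induce (G := G) X).toHom,
      Subtype.val_injective⟩
  obtain ⟨c0, hc0, k, hk⟩ := hmin X (G.induce X) hplanar (by rw [hXcard]; omega)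
  let c : V → Fin 5 := fun x => if h : x ∈ X then c0 ⟨x, h⟩ else 0
  have hcX : ∀ x (h : x ∈ X), c x = c0 ⟨x, h⟩ := fun x h => by simp only [c, dif_pos h]
  have hP : ProperOn G c X := by
    intro x hx y hy hxy
    rw [hcX x hx, hcX y hy]
    exact hc0 (u := ⟨x, hx⟩) (w := ⟨y, hy⟩) hxy
  let Kx : Finset V := Finset.univ.filter fun x => x ∈ X ∧ c x = k
  have hKx : 6 * Kx.card + 6 ≤ Fintype.card V := by
    have h1 : Kx.card ≤ Nat.card {w : X | c0 w = k} := by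
      have h2 : Kx ⊆ (Finset.univ.filter fun w : X => c0 w = k).image Subtype.val := by
        intro x hx
        simp only [Kx, Finset.mem_filter, Finset.mem_univ, true_and] at hx
        rw [Finset.mem_image]
        refine ⟨⟨x, hx.1⟩, ?_, rfl⟩
        simp only [Finset.mem_filter, Finset.mem_univ, true_and]
        rw [← hcX]; exact hx.2
      refine (Finset.card_le_card h2).trans (Finset.card_image_le.trans ?_)
      rw [Nat.card_eq_fintype_card, ← Fintype.card_subtype]
      exact le_of_eq (Fintype.card_congr (Equiv.refl _))
    rw [hXcard] at hk
    omega
  have hfin : ∀ (c' : V → Fin 5) (y : V), (∀ a b, G.Adj a b → c' a ≠ c' b) →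
      (∀ x, c' x = k → x = y ∨ x ∈ Kx) → False := by
    intro c' y h1 h2
    refine hno ⟨c', fun a b h => h1 a b h, k, ?_⟩
    have h3 : Nat.card {x : V | c' x = k} ≤ Kx.card + 1 := by
      have h4 : (Finset.univ.filter fun x => c' x = k) ⊆ insert y Kx := by
        intro x hx
        rw [Finset.mem_insert]
        exact h2 x (by simpa using hx)
      refine le_trans ?_ ((Finset.card_le_card h4).trans (Finset.card_insert_le _ _))
      rw [Nat.card_eq_fintype_card, ← Fintype.card_subtype]
      exact le_of_eq (Fintype.card_congr (Equiv.refl _))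
    omega
  have hmemX : ∀ x, x ∈ X ↔ x ≠ v ∧ x ∉ U := by
    intro x
    show x ∉ insert v U ↔ _
    simp
  have hvX : v ∉ X := fun h => ((hmemX v).1 h).1 rfl
  have hnbX : ∀ x ∈ X, G.Adj v x → x ∈ W := by
    intro x hx hvx
    rw [hW]
    exact ⟨hvx, fun h => ((hmemX x).1 hx).2 ((hU x).2 ⟨hvx, h⟩)⟩
  have hWX : ∀ x ∈ W, x ∈ X := by
    intro x hx
    rw [hW] at hx
    rw [hmemX]
    exact ⟨hx.1.ne.symm, fun h => hx.2 ((hU x).1 h).2⟩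
  have hUX : ∀ y ∈ U, y ∉ insert v X := by
    rintro y hy (h | h)
    · exact hvU (h ▸ hy)
    · exact ((hmemX y).1 h).2 hy
  by_cases hcase : ∃ w0 ∈ W, c w0 = k
  · obtain ⟨w0, hw0, hw0k⟩ := hcase
    -- color `v` for free
    have hcard : (Finset.univ.filter fun x => G.Adj v x ∧ x ∈ X ∧ c x ≠ k).card ≤ 4 := by
      have : (Finset.univ.filter fun x => G.Adj v x ∧ x ∈ X ∧ c x ≠ k) ⊆ W := by
        intro x hx
        simp only [Finset.mem_filter, Finset.mem_univ, true_and] at hx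
        exact hnbX x hx.2.1 hx.1
      have := Finset.card_le_card this
      omega
    obtain ⟨c₁, h1, h2, h3⟩ := extend_free G σ hT c X k v hvX hP (by convert hcard)
    obtain ⟨r, ys, hord⟩ := order_around G σ hT v w0 ((hW w0).1 hw0).1 W U
      (fun x hx => by rw [hU, hW]; tauto) (fun x hx => ((hU x).1 hx).1) hw0 hWc
    obtain ⟨c₂, g1, g2, g3⟩ := extend_many G σ hT k r _ (U.erase ys) (insert v X) c₁ rfl
      (fun y hy => hUX y (Finset.mem_of_mem_erase hy)) h1
      (fun y hy => ((hU y).1 (Finset.mem_of_mem_erase hy)).2) (by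
        intro y hy
        rw [Finset.mem_erase] at hy
        rcases hord y hy.2 hy.1 with h | ⟨y', e1, e2, e3⟩
        · exact Or.inl ⟨w0, Or.inr (hWX w0 hw0), h, (h2 w0 (hWX w0 hw0)).2 hw0k⟩
        · exact Or.inr ⟨y', e2, hUX y' e1, Or.inr e3⟩)
    -- the color class of `k` on what is colored so far
    have hclass : ∀ x ∈ insert v X ∪ ((U.erase ys : Finset V) : Set V), c₂ x = k → x ∈ Kx := by
      intro x hx hxk
      rcases hx with hx | hx
      · rw [g2 x hx] at hxk
        rcases hx with rfl | hx
        · exact absurd hxk h3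
        · rw [h2 x hx] at hxk
          simp only [Kx, Finset.mem_filter, Finset.mem_univ, true_and]
          exact ⟨hx, hxk⟩
      · exact absurd hxk (g3 x hx)
    have hall : ∀ x, x ≠ ys → x ∈ insert v X ∪ ((U.erase ys : Finset V) : Set V) := by
      intro x hx
      by_cases hxU : x ∈ U
      · exact Or.inr (Finset.mem_coe.2 (Finset.mem_erase.2 ⟨hx, hxU⟩))
      · by_cases hxv : x = v
        · exact Or.inl (Or.inl hxv)
        · exact Or.inl (Or.inr ((hmemX x).2 ⟨hxv, hxU⟩))
    by_cases hysin : ys ∈ insert v X ∪ ((U.erase ys : Finset V) : Set V)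
    · have hall' : ∀ x, x ∈ insert v X ∪ ((U.erase ys : Finset V) : Set V) := by
        intro x
        by_cases hx : x = ys
        · rw [hx]; exact hysin
        · exact hall x hx
      exact hfin c₂ v (fun a b h => g1 a (hall' a) b (hall' b) h)
        (fun x hx => Or.inr (hclass x (hall' x) hx))
    · set X' := insert v X ∪ ((U.erase ys : Finset V) : Set V) with hX'
      have hysU : ys ∈ U := by
        by_contra h
        apply hysin
        by_cases hxv : ys = v
        · exact Or.inl (Or.inl hxv)
        · exact Or.inl (Or.inr ((hmemX ys).2 ⟨hxv, h⟩))
      have hall' : ∀ x, x ∈ insert ys X' := by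
        intro x
        by_cases hx : x = ys
        · exact Or.inl hx
        · exact Or.inr (hall x hx)
      by_cases hkn : ∃ x ∈ X', G.Adj ys x ∧ c₂ x = k
      · obtain ⟨x0, hx0, hyx0, hx0k⟩ := hkn
        have hcard : (Finset.univ.filter fun x => G.Adj ys x ∧ x ∈ X' ∧ c₂ x ≠ k).card ≤ 4 := by
          have hsub : (Finset.univ.filter fun x => G.Adj ys x ∧ x ∈ X' ∧ c₂ x ≠ k) ⊆
              (Finset.univ.filter fun x => G.Adj ys x).erase x0 := by
            intro x hx
            simp only [Finset.mem_filter, Finset.mem_univ, true_and, Finset.mem_erase] at hx ⊢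
            exact ⟨fun h => hx.2.2 (h ▸ hx0k), hx.1⟩
          refine (Finset.card_le_card hsub).trans ?_
          rw [Finset.card_erase_of_mem (by simpa using hyx0), ← deg_eq_card,
            ((hU ys).1 hysU).2]
        obtain ⟨c₃, f1, f2, f3⟩ := extend_free G σ hT c₂ X' k ys hysin g1 (by convert hcard)
        refine hfin c₃ ys (fun a b h => f1 a (hall' a) b (hall' b) h) fun x hx => ?_
        by_cases hxy : x = ys
        · exact Or.inl hxy
        · exact Or.inr (hclass x (hall x hxy) ((f2 x (hall x hxy)).1 hx))
      · push Not at hkn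
        obtain ⟨c₃, f1, f2, f3⟩ := extend_color G c₂ X' ys k hysin g1 hkn
        refine hfin c₃ ys (fun a b h => f1 a (hall' a) b (hall' b) h) fun x hx => ?_
        by_cases hxy : x = ys
        · exact Or.inl hxy
        · exact Or.inr (hclass x (hall x hxy) (by rw [← f2 x (hall x hxy)]; exact hx))
  · push Not at hcase
    obtain ⟨c₁, h1, h2, h3⟩ := extend_color G c X v k hvX hP
      (fun x hx hvx => hcase x (hnbX x hx hvx))
    obtain ⟨c₂, g1, g2, g3⟩ := extend_many G σ hT k (fun _ => 0) _ U (insert v X) c₁ rfl hUX h1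
      (fun y hy => ((hU y).1 hy).2)
      (fun y hy => Or.inl ⟨v, Or.inl rfl, ((hU y).1 hy).1.symm, h3⟩)
    have hall : ∀ x, x ∈ insert v X ∪ (U : Set V) := by
      intro x
      by_cases hxU : x ∈ U
      · exact Or.inr hxU
      · by_cases hxv : x = v
        · exact Or.inl (Or.inl hxv)
        · exact Or.inl (Or.inr ((hmemX x).2 ⟨hxv, hxU⟩))
    refine hfin c₂ v (fun a b h => g1 a (hall a) b (hall b) h) fun x hx => ?_
    rcases hall x with (h | h) | h
    · exact Or.inl h
    · right
      rw [g2 x (Or.inr h), h2 x h] at hx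
      simp only [Kx, Finset.mem_filter, Finset.mem_univ, true_and]
      exact ⟨h, hx⟩
    · exact absurd hx (g3 x h)

end Helpers

theorem statement11 [Fintype V] (G : SimpleGraph V) (σ : Equiv.Perm G.Dart)
    (hG : IsMinimalCounterexample G σ) :
    ∀ (v : V) (d : ℕ), 8 ≤ d → deg G v = d →
      Nat.card {u : V | G.Adj v u ∧ deg G u = 5} ≤ d - 4 := by
  classical
  intro v d hd hdeg
  by_contra hcon
  push Not at hcon
  let U : Finset V := Finset.univ.filter fun x => G.Adj v x ∧ deg G x = 5
  let W : Finset V := Finset.univ.filter fun x => G.Adj v x ∧ deg G x ≠ 5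
  have hU : Nat.card {u : V | G.Adj v u ∧ deg G u = 5} = U.card := by
    rw [Nat.card_eq_fintype_card, ← Fintype.card_subtype]
    exact Fintype.card_congr (Equiv.refl _)
  have hUW : U.card + W.card = d := by
    rw [← hdeg, deg_eq_card,
      ← Finset.card_filter_add_card_filter_not (s := Finset.univ.filter fun x => G.Adj v x)
        (fun x => deg G x = 5), Finset.filter_filter,
      Finset.filter_filter]
  rw [hU] at hcon
  exact main_contra G σ hG v U W (fun x => by simp [U]) (fun x => by simp [W])
    (by omega) (by omega)
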